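/- Let X ⊂ P^{n+1} be a hypersurface of degree 2 ≤ d ≤ q and dimension n ≥ 3 over F_q with N_q(X) = Θ_n^{d,q}. Then X is singular, i.e., X has at least one singular F_q-point. -/

import Mathlib

open MvPolynomial Module Finset

theorem MvPolynomial.derivation_aeval_eq_sum {K σ A : Type*} [CommRing K] [Fintype σ] [CommRing A]
    [Algebra K A] (D : Derivation K A A) (g : σ → A) (P : MvPolynomial σ K) :
    D (aeval g P) = ∑ i, aeval g (pderiv i P) * D (g i) := by
  classical
  induction P using MvPolynomial.induction_on with
  | C a => simp
  | add p r hp hr => simp [hp, hr, add_mul, Finset.sum_add_distrib]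
  | mul_X p i hp =>
    simp only [map_mul, aeval_X, Derivation.leibniz, hp, smul_eq_mul, pderiv_X, map_add, add_mul,
      Finset.sum_add_distrib, Pi.single_apply, Finset.mul_sum]
    simp [Finset.sum_ite_eq, mul_assoc, apply_ite]

/-- The restriction of a polynomial to the span of a family of vectors, in the coordinates given
by that family. -/
noncomputable def MvPolynomial.restrictSpan {K σ τ : Type*} [CommRing K] [Fintype τ]
    (b : τ → σ → K) (P : MvPolynomial σ K) : MvPolynomial τ K :=
  aeval (fun j => ∑ i, C (b i j) * X i) P

theorem MvPolynomial.eval_restrictSpan {K σ τ : Type*} [CommRing K] [Fintype τ]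
    (b : τ → σ → K) (P : MvPolynomial σ K) (t : τ → K) :
    eval t (restrictSpan b P) = eval (∑ i, t i • b i) P := by
  unfold restrictSpan
  rw [← coe_aeval_eq_eval, ← coe_aeval_eq_eval, RingHom.coe_coe, RingHom.coe_coe,
    ← AlgHom.comp_apply, comp_aeval]
  congr 2
  ext j
  simp [mul_comm]

theorem MvPolynomial.IsHomogeneous.restrictSpan {K σ τ : Type*} [CommRing K] [Fintype τ]
    {P : MvPolynomial σ K} {d : ℕ} (hP : P.IsHomogeneous d) (b : τ → σ → K) :
    (restrictSpan b P).IsHomogeneous d := by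
  have h := hP.aeval (S := K) (fun j => ∑ i, C (b i j) * X i) (n := 1) fun j =>
    IsHomogeneous.sum _ _ _ fun i _ => by
      simpa using (isHomogeneous_C _ (b i j)).mul (isHomogeneous_X K i)
  rwa [one_mul] at h

theorem MvPolynomial.pderiv_restrictSpan {K σ τ : Type*} [CommRing K] [Fintype σ] [Fintype τ]
    (b : τ → σ → K) (P : MvPolynomial σ K) (t : τ) :
    pderiv t (restrictSpan b P) = ∑ i, restrictSpan b (pderiv i P) * C (b t i) := by
  classical
  unfold restrictSpan
  rw [derivation_aeval_eq_sum]
  simp [pderiv_X, Pi.single_apply]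

theorem MvPolynomial.IsHomogeneous.eval_smul {K σ : Type*} [CommRing K]
    {P : MvPolynomial σ K} {d : ℕ} (hP : P.IsHomogeneous d) (s : K) (v : σ → K) :
    eval (s • v) P = s ^ d * eval v P := by
  rw [eval_eq, eval_eq, Finset.mul_sum]
  refine Finset.sum_congr rfl fun m hm => ?_
  have hd : ∑ i ∈ m.support, m i = d := by
    rw [← hP (mem_support_iff.1 hm), Finsupp.weight_apply, Finsupp.sum]
    simp
  simp only [Pi.smul_apply, smul_eq_mul, mul_pow, Finset.prod_mul_distrib,
    Finset.prod_pow_eq_pow_sum, hd]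
  ring

section FiniteField

variable {K : Type*} [Field K] [Fintype K]

/-- A form of degree at most `q` vanishing on a subspace has zero derivative along that subspace
at each of its points. -/
theorem sum_mul_eval_pderiv_eq_zero {σ : Type*} [Fintype σ] {P : MvPolynomial σ K} {d : ℕ}
    (hP : P.IsHomogeneous d) (hd : d ≤ Fintype.card K) {A : Submodule K (σ → K)}
    (hA : ∀ a ∈ A, eval a P = 0) {p a : σ → K} (hp : p ∈ A) (ha : a ∈ A) :
    ∑ i, eval p (pderiv i P) * a i = 0 := by
  have h0 : restrictSpan ![p, a] P = 0 := by
    refine (hP.restrictSpan _).eq_zero_of_forall_eval_eq_zero_of_le_card (fun r => ?_)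
      (by simpa using hd)
    rw [eval_restrictSpan]
    apply hA
    simpa using A.add_mem (A.smul_mem _ hp) (A.smul_mem _ ha)
  have h1 := congrArg (fun Q => eval ![1, 0] (pderiv 1 Q)) h0
  simpa [pderiv_restrictSpan, eval_restrictSpan] using h1

theorem exists_totalDegree_le_of_eval_cons_zero {k e : ℕ} {G : MvPolynomial (Fin (k + 1)) K}
    (hG : G.IsHomogeneous (e + 1)) (he : e + 1 ≤ Fintype.card K)
    (h0 : ∀ t : Fin k → K, eval (Fin.cons 0 t) G = 0) :
    ∃ f : MvPolynomial (Fin k) K, f.totalDegree ≤ e ∧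
      ∀ t : Fin k → K, eval t f = eval (Fin.cons 1 t) G := by
  have hc : (finSuccEquiv K k G).coeff 0 = 0 := by
    refine (hG.finSuccEquiv_coeff_isHomogeneous 0 (e + 1) (by simp))
      |>.eq_zero_of_forall_eval_eq_zero_of_le_card (fun r => ?_) (by simpa using he)
    rw [← h0 r, eval_eq_eval_mv_eval', ← coeff_eval_eq_eval_coeff,
      Polynomial.coeff_zero_eq_eval_zero]
  refine ⟨(finSuccEquiv K k G).eval 1, ?_, fun t => ?_⟩
  · rw [Polynomial.eval_eq_sum_range]
    refine totalDegree_finsetSum_le fun i hi => ?_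
    rw [one_pow, mul_one]
    rcases i with _ | i
    · simp [hc]
    · by_cases hie : i ≤ e
      · exact (hG.finSuccEquiv_coeff_isHomogeneous (i + 1) (e - i) (by omega)).totalDegree_le.trans
          (by omega)
      · have : (finSuccEquiv K k G).coeff (i + 1) = 0 := by
          apply Polynomial.coeff_eq_zero_of_natDegree_lt
          rw [natDegree_finSuccEquiv]
          exact ((degreeOf_le_totalDegree _ _).trans hG.totalDegree_le).trans_lt (by omega)
        simp [this]
  · rw [eval_eq_eval_mv_eval', Polynomial.eval_one_map]

theorem card_zeros_mul_card_le {k e : ℕ} {f : MvPolynomial (Fin k) K} (hf : f.totalDegree ≤ e)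
    (hf0 : f ≠ 0) :
    Nat.card {t : Fin k → K // eval t f = 0} * Fintype.card K ≤ e * Fintype.card K ^ k := by
  classical
  have h := schwartz_zippel_totalDegree hf0 (Finset.univ : Finset K)
  have hq : (0 : ℚ≥0) < Fintype.card K := by exact_mod_cast Fintype.card_pos
  rw [Finset.card_univ, div_le_div_iff₀ (by positivity) hq] at h
  rw [Nat.card_eq_fintype_card, Fintype.card_subtype]
  rw [Fintype.piFinset_univ] at h
  norm_cast at h
  exact h.trans (Nat.mul_le_mul_right _ hf)


/-- Every nontrivial translate of a subspace of zeros contains few zeros. -/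
theorem card_zeros_translate_mul_card_le {σ : Type*} [Finite σ] {P : MvPolynomial σ K} {e : ℕ}
    (hP : P.IsHomogeneous (e + 1)) (he : e + 1 ≤ Fintype.card K) {M : Submodule K (σ → K)}
    (hM : ∀ a ∈ M, eval a P = 0) {w : σ → K} (hw : ¬ ∀ a ∈ M ⊔ K ∙ w, eval a P = 0) :
    Nat.card {m : M // eval (w + (m : σ → K)) P = 0} * Fintype.card K ≤
      e * Fintype.card K ^ finrank K M := by
  classical
  have := Fintype.ofFinite σ
  let b := finBasis K M
  let c : Fin (finrank K M + 1) → σ → K := Fin.cons w fun i => (b i : σ → K)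
  have hcoe (t : Fin (finrank K M) → K) :
      ((b.equivFun.symm t : M) : σ → K) = ∑ i, t i • (b i : σ → K) := by
    simp [Basis.equivFun_symm_apply]
  have heval (s : K) (t : Fin (finrank K M) → K) :
      eval (Fin.cons s t) (restrictSpan c P) = eval (s • w + ((b.equivFun.symm t : M) : σ → K)) P := by
    rw [eval_restrictSpan, Fin.sum_univ_succ, hcoe]
    simp [c]
  obtain ⟨f, hf, hfe⟩ := exists_totalDegree_le_of_eval_cons_zero (hP.restrictSpan c) he fun t => by
    rw [heval, zero_smul, zero_add]
    exact hM _ (Subtype.prop _)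
  have hfe' (t) : eval t f = eval (w + ((b.equivFun.symm t : M) : σ → K)) P := by
    rw [hfe, heval, one_smul]
  have hf0 : f ≠ 0 := by
    rintro rfl
    have hz (m : M) : eval (w + (m : σ → K)) P = 0 := by
      simpa using (hfe' (b.equivFun m)).symm
    refine hw fun a ha => ?_
    obtain ⟨m, hm, y, hy, rfl⟩ := Submodule.mem_sup.1 ha
    obtain ⟨s, rfl⟩ := Submodule.mem_span_singleton.1 hy
    by_cases hs : s = 0
    · simpa [hs] using hM m hm
    · have h1 : m + s • w = s • (w + (s⁻¹ • (⟨m, hm⟩ : M) : M)) := by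
        simp [smul_smul, hs, add_comm]
      rw [h1, hP.eval_smul, hz, mul_zero]
  refine le_of_eq_of_le ?_ (card_zeros_mul_card_le hf hf0)
  congr 1
  refine Nat.card_congr (b.equivFun.toEquiv.subtypeEquiv fun m => ?_)
  rw [hfe']
  simp

/-- A bound for the number of zeros of a form in terms of the dimension of a subspace which is
maximal among those consisting of zeros. -/
theorem card_zeros_mul_card_add_le {σ : Type*} [Fintype σ] {P : MvPolynomial σ K} {e : ℕ}
    (hP : P.IsHomogeneous (e + 1)) (he : e + 1 ≤ Fintype.card K) {M : Submodule K (σ → K)}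
    (hM : Maximal (fun A : Submodule K (σ → K) => ∀ a ∈ A, eval a P = 0) M) :
    Nat.card {v : σ → K // eval v P = 0} * Fintype.card K + e * Fintype.card K ^ finrank K M ≤
      Fintype.card K ^ (finrank K M + 1) + e * Fintype.card K ^ Fintype.card σ := by
  classical
  set q := Fintype.card K
  set k := finrank K M
  have hMc : Fintype.card M = q ^ k := by
    rw [← Nat.card_eq_fintype_card, Module.natCard_eq_pow_finrank (K := K),
      Nat.card_eq_fintype_card]
  have hVc : Fintype.card (σ → K) = q ^ Fintype.card σ := by simp [q]
  have hin : #{w : σ → K | w ∈ M} = q ^ k := by rw [← Fintype.card_subtype, ← hMc]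
  have hout : #{w : σ → K | w ∉ M} + q ^ k = q ^ Fintype.card σ := by
    rw [← hin, ← hVc, add_comm, Finset.card_filter_add_card_filter_not, Finset.card_univ]
  have hsplit : #{v : σ → K | eval v P = 0} = q ^ k + #{v : σ → K | v ∉ M ∧ eval v P = 0} := by
    rw [← Finset.card_filter_add_card_filter_not (fun v => v ∈ M), Finset.filter_filter,
      Finset.filter_filter, ← hin]
    congr 2
    · ext v
      simpa using hM.prop v
    · ext v
      simp [and_comm]
  have hdouble : ∑ w : σ → K with w ∉ M, #{m : M | eval (w + (m : σ → K)) P = 0} =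
      q ^ k * #{v : σ → K | v ∉ M ∧ eval v P = 0} := by
    simp_rw [Finset.card_filter]
    rw [Finset.sum_comm, ← hMc, ← Finset.card_univ, ← smul_eq_mul, ← Finset.sum_const]
    refine Finset.sum_congr rfl fun m _ => ?_
    rw [Finset.sum_filter]
    refine Fintype.sum_equiv (Equiv.addRight (m : σ → K)) _ _ fun w => ?_
    simp [M.add_mem_iff_left m.2, ite_and]
  have hbound (w : σ → K) (hw : w ∉ M) : #{m : M | eval (w + (m : σ → K)) P = 0} * q ≤ e * q ^ k := by
    rw [← Fintype.card_subtype, ← Nat.card_eq_fintype_card]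
    refine card_zeros_translate_mul_card_le hP he hM.prop fun h => hw ?_
    exact hM.le_of_ge h le_sup_left (Submodule.mem_sup_right (Submodule.mem_span_singleton_self w))
  have hsum : q ^ k * (#{v : σ → K | v ∉ M ∧ eval v P = 0} * q) ≤
      q ^ k * (#{w : σ → K | w ∉ M} * e) := by
    rw [← mul_assoc, ← hdouble, Finset.sum_mul]
    refine (Finset.sum_le_card_nsmul _ _ (e * q ^ k) fun w hw => hbound w (by simpa using hw)).trans
      (le_of_eq ?_)
    rw [smul_eq_mul]
    ring
  have hq : 0 < q := Fintype.card_pos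
  have hle := Nat.le_of_mul_le_mul_left hsum (by positivity)
  rw [Nat.card_eq_fintype_card, Fintype.card_subtype, hsplit, ← hout]
  ring_nf at hle ⊢
  omega

/-- The affine cone over the zero set of a form, counted through its projective points. -/
theorem card_zeros_eq {σ : Type*} [Finite σ] {P : MvPolynomial σ K} {d : ℕ}
    (hP : P.IsHomogeneous d) (hd : d ≠ 0) :
    Nat.card {v : σ → K // eval v P = 0} =
      Nat.card {x : Projectivization K (σ → K) | eval x.rep P = 0} * (Fintype.card K - 1) + 1 := by
  classical
  have hrep (v : σ → K) (hv : v ≠ 0) : ∃ u : Kˣ, u • (Projectivization.mk K v hv).rep = v := by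
    obtain ⟨u, hu⟩ := Projectivization.exists_smul_eq_mk_rep K v hv
    exact ⟨u⁻¹, by rw [← hu, inv_smul_smul]⟩
  have hsmul (u : Kˣ) (v : σ → K) : eval (u • v) P = 0 ↔ eval v P = 0 := by
    rw [Units.smul_def, hP.eval_smul]
    simp
  have h0 : eval (0 : σ → K) P = 0 := by
    rw [← zero_smul K (0 : σ → K), hP.eval_smul, zero_pow hd, zero_mul]
  let φ : Option ({x : Projectivization K (σ → K) | eval x.rep P = 0} × Kˣ) →
      {v : σ → K // eval v P = 0} := fun o =>
    o.elim ⟨0, h0⟩ fun y => ⟨y.2 • y.1.1.rep, (hsmul _ _).2 y.1.2⟩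
  have hne (u : Kˣ) (x : Projectivization K (σ → K)) : u • x.rep ≠ 0 :=
    (smul_ne_zero_iff_ne u).2 x.rep_nonzero
  have hφ : Function.Bijective φ := by
    refine ⟨?_, fun ⟨v, hv⟩ => ?_⟩
    · rintro (_ | ⟨⟨x, hx⟩, u⟩) (_ | ⟨⟨y, hy⟩, w⟩) h
      · rfl
      · exact absurd (congrArg Subtype.val h).symm (hne w y)
      · exact absurd (congrArg Subtype.val h) (hne u x)
      · have h' : u • x.rep = w • y.rep := congrArg Subtype.val h
        have hxy : x = y := by
          rw [← x.mk_rep, ← y.mk_rep, Projectivization.mk_eq_mk_iff]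
          exact ⟨u⁻¹ * w, by rw [mul_smul, ← h', inv_smul_smul]⟩
        subst hxy
        have hu : u = w := Units.ext (smul_left_injective K x.rep_nonzero h')
        rw [hu]
    · by_cases hv0 : v = 0
      · exact ⟨none, Subtype.ext hv0.symm⟩
      · obtain ⟨u, hu⟩ := hrep v hv0
        refine ⟨some (⟨Projectivization.mk K v hv0, ?_⟩, u), Subtype.ext hu⟩
        change eval _ P = 0
        rw [← hsmul u, hu, hv]
  rw [← Nat.card_congr (Equiv.ofBijective φ hφ), Finite.card_option, Nat.card_prod,
    Nat.card_units, Nat.card_eq_fintype_card (α := K)]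

/-- If three subspaces of zeros of a form span the whole space, any common point is singular. -/
theorem eval_pderiv_eq_zero_of_sup_eq_top {σ : Type*} [Fintype σ] {P : MvPolynomial σ K} {d : ℕ}
    (hP : P.IsHomogeneous d) (hd : d ≤ Fintype.card K) {A B C : Submodule K (σ → K)}
    (hA : ∀ a ∈ A, eval a P = 0) (hB : ∀ a ∈ B, eval a P = 0) (hC : ∀ a ∈ C, eval a P = 0)
    (htop : A ⊔ B ⊔ C = ⊤) {p : σ → K} (hpA : p ∈ A) (hpB : p ∈ B) (hpC : p ∈ C) (i : σ) :
    eval p (pderiv i P) = 0 := by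
  classical
  let D : (σ → K) →ₗ[K] K := Fintype.linearCombination K fun i => eval p (pderiv i P)
  have hD (a : σ → K) : D a = ∑ i, eval p (pderiv i P) * a i := by
    simp [D, Fintype.linearCombination_apply, mul_comm]
  have hker : A ⊔ B ⊔ C ≤ LinearMap.ker D := by
    refine sup_le (sup_le ?_ ?_) ?_ <;> intro a ha <;> rw [LinearMap.mem_ker, hD]
    · exact sum_mul_eval_pderiv_eq_zero hP hd hA hpA ha
    · exact sum_mul_eval_pderiv_eq_zero hP hd hB hpB ha
    · exact sum_mul_eval_pderiv_eq_zero hP hd hC hpC ha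
  have h : Pi.single i 1 ∈ LinearMap.ker D := hker (htop ▸ Submodule.mem_top)
  rw [LinearMap.mem_ker, hD] at h
  simpa [Pi.single_apply] using h

end FiniteField

/-- A family of subspaces of codimension at most two, not all contained in any given proper
subspace, has three members which together span and share a nonzero vector. -/
theorem exists_three_sup_eq_top {K V : Type*} [Field K] [AddCommGroup V] [Module K V]
    [FiniteDimensional K V] {n : ℕ} (hn : 3 ≤ n) (hV : finrank K V = n + 2)
    {S : Set (Submodule K V)} (hS : ∀ A ∈ S, n ≤ finrank K A)
    (hcov : ∀ H : Submodule K V, H ≠ ⊤ → ∃ A ∈ S, ¬ A ≤ H) :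
    ∃ A ∈ S, ∃ B ∈ S, ∃ C ∈ S, A ⊔ B ⊔ C = ⊤ ∧ ∃ p ≠ 0, p ∈ A ∧ p ∈ B ∧ p ∈ C := by
  have hpoint (W : Submodule K V) (hW : 0 < finrank K W) : ∃ p ≠ 0, p ∈ W := by
    obtain ⟨p, hp, hp0⟩ := W.exists_mem_ne_zero_of_ne_bot (by rintro rfl; simp at hW)
    exact ⟨p, hp0, hp⟩
  have hpair (A) (hA : A ∈ S) (B) (hB : B ∈ S) (h : A ⊔ B = ⊤) :
      ∃ A ∈ S, ∃ B ∈ S, ∃ C ∈ S, A ⊔ B ⊔ C = ⊤ ∧ ∃ p ≠ 0, p ∈ A ∧ p ∈ B ∧ p ∈ C := by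
    have h1 := Submodule.finrank_sup_add_finrank_inf_eq A B
    rw [h, finrank_top, hV] at h1
    have := hS A hA
    have := hS B hB
    obtain ⟨p, hp0, hp⟩ := hpoint (A ⊓ B) (by omega)
    exact ⟨A, hA, B, hB, B, hB, by rw [sup_assoc, sup_idem, h], p, hp0, hp.1, hp.2, hp.2⟩
  have hlt (H : Submodule K V) (hH : H ≠ ⊤) : finrank K H < n + 2 :=
    hV ▸ Submodule.finrank_lt hH
  have : Nontrivial V := Module.nontrivial_of_finrank_pos (R := K) (by omega)
  obtain ⟨A, hA, -⟩ := hcov ⊥ bot_ne_top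
  by_cases hAtop : A = ⊤
  · exact hpair A hA A hA (by rw [hAtop, sup_idem])
  obtain ⟨B, hB, hBA⟩ := hcov A hAtop
  by_cases hAB : A ⊔ B = ⊤
  · exact hpair A hA B hB hAB
  obtain ⟨C, hC, hCAB⟩ := hcov (A ⊔ B) hAB
  by_cases hAC : A ⊔ C = ⊤
  · exact hpair A hA C hC hAC
  have hA1 := hS A hA
  have hB1 := hS B hB
  have hC1 := hS C hC
  have hAB1 := hlt _ hAB
  have hAC1 := hlt _ hAC
  have hAB2 : finrank K A < finrank K ↥(A ⊔ B) := Submodule.finrank_lt_finrank_of_lt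
    (left_lt_sup.2 hBA)
  have hABC : finrank K ↥(A ⊔ B) < finrank K ↥(A ⊔ B ⊔ C) := Submodule.finrank_lt_finrank_of_lt
    (left_lt_sup.2 hCAB)
  have htop : A ⊔ B ⊔ C = ⊤ := by
    by_contra h
    have := hlt _ h
    omega
  have h1 := Submodule.finrank_sup_add_finrank_inf_eq A B
  have h2 := Submodule.finrank_sup_add_finrank_inf_eq A C
  have h3 := Submodule.finrank_sup_add_finrank_inf_eq (A ⊓ B) (A ⊓ C)
  have h4 : finrank K ↥(A ⊓ B ⊔ A ⊓ C) ≤ finrank K A :=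
    Submodule.finrank_mono (sup_le inf_le_left inf_le_left)
  obtain ⟨p, hp0, hp⟩ := hpoint (A ⊓ B ⊓ (A ⊓ C)) (by omega)
  exact ⟨A, hA, B, hB, C, hC, htop, p, hp0, hp.1.1, hp.1.2, hp.2.2⟩


/-- A form of degree `e + 1 ≤ q` in `k + 3 ≥ 5` variables with the extremal number of zeros has a
singular rational point. -/
theorem exists_singular_of_card_zeros {K σ : Type*} [Field K] [Fintype K] [Fintype σ]
    {P : MvPolynomial σ K} {e k : ℕ} (hk : 2 ≤ k) (hσ : Fintype.card σ = k + 3) (he1 : 1 ≤ e)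
    (he : e < Fintype.card K) (hP : P.IsHomogeneous (e + 1))
    (hZ : Nat.card {v : σ → K // eval v P = 0} + e * Fintype.card K ^ k =
      Fintype.card K ^ (k + 1) + e * Fintype.card K ^ (k + 2)) :
    ∃ v : σ → K, v ≠ 0 ∧ eval v P = 0 ∧ ∀ i, eval v (pderiv i P) = 0 := by
  classical
  have hcov (H : Submodule K (σ → K)) (hH : H ≠ ⊤) : ∃ v ∉ H, eval v P = 0 := by
    by_contra! h
    have h1 : Nat.card {v : σ → K // eval v P = 0} ≤ Nat.card H :=
      Nat.card_le_card_of_injective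
        (fun v => (⟨v.1, by_contra fun hv => h v.1 hv v.2⟩ : H))
        fun v w hvw => Subtype.ext (congrArg (fun x : H => (x : σ → K)) hvw)
    have h2 : finrank K H ≤ k + 2 := by
      have := Submodule.finrank_lt hH
      rw [finrank_fintype_fun_eq_card, hσ] at this
      omega
    rw [Module.natCard_eq_pow_finrank (K := K) (V := H), Nat.card_eq_fintype_card (α := K)] at h1
    have h3 : Fintype.card K ^ finrank K H ≤ Fintype.card K ^ (k + 2) :=
      Nat.pow_le_pow_right (by omega) h2
    have h4 : Fintype.card K ^ (k + 2) ≤ e * Fintype.card K ^ (k + 2) :=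
      Nat.le_mul_of_pos_left _ (by omega)
    have h5 : e * Fintype.card K ^ k < Fintype.card K ^ (k + 1) := by
      rw [pow_succ, mul_comm]
      exact Nat.mul_lt_mul_of_pos_left (by omega) (pow_pos (by omega) k)
    omega
  obtain ⟨A, hA, B, hB, C, hC, htop, p, hp0, hpA, hpB, hpC⟩ :=
    exists_three_sup_eq_top (K := K) (V := σ → K) (n := k + 1) (by omega) (by simp [hσ])
      (S := {A : Submodule K (σ → K) | (∀ a ∈ A, eval a P = 0) ∧ k + 1 ≤ finrank K A})
      (fun A hA => hA.2) fun H hH => by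
        obtain ⟨v, hvH, hv⟩ := hcov H hH
        have hspan : ∀ a ∈ K ∙ v, eval a P = 0 := by
          intro a ha
          obtain ⟨s, rfl⟩ := Submodule.mem_span_singleton.1 ha
          rw [hP.eval_smul, hv, mul_zero]
        obtain ⟨M, hvM, hM⟩ := (Set.toFinite
          {A : Submodule K (σ → K) | ∀ a ∈ A, eval a P = 0}).exists_le_maximal hspan
        have hvM' : v ∈ M := hvM (Submodule.mem_span_singleton_self v)
        refine ⟨M, ⟨hM.prop, ?_⟩, fun h => hvH (h hvM')⟩
        have hle := card_zeros_mul_card_add_le hP (by omega) hM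
        rw [hσ] at hle
        by_contra! hlt
        have hpow : Fintype.card K ^ finrank K M < Fintype.card K ^ (k + 1) :=
          Nat.pow_lt_pow_right (by omega) hlt
        have hZq := congrArg (· * Fintype.card K) hZ
        simp only [add_mul, mul_assoc, ← pow_succ] at hZq
        rw [pow_succ _ (k + 1), show k + 2 + 1 = k + 3 from rfl] at hZq
        rw [pow_succ _ (finrank K M)] at hle
        have h1 : Fintype.card K ^ (k + 1) * Fintype.card K + e * Fintype.card K ^ finrank K M ≤
            Fintype.card K ^ finrank K M * Fintype.card K + e * Fintype.card K ^ (k + 1) := by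
          omega
        nlinarith
  exact ⟨p, hp0, hA.1 p hpA, eval_pderiv_eq_zero_of_sup_eq_top hP (by omega) hA.1 hB.1 hC.1 htop
    hpA hpB hpC⟩


/-- a hypersurface `X ⊂ P^{n+1}` of degree `2 ≤ d ≤ q`, `n ≥ 3`, with
`N_q(X) = Θ_n^{d,q}` is singular: it has a singular `F_q`-point. -/
theorem stmt13 (q d n : ℕ) (hq : IsPrimePow q) (hn : 3 ≤ n) (hd2 : 2 ≤ d) (hdq : d ≤ q)
    (K : Type*) [Field K] [Fintype K] (hK : Fintype.card K = q)
    (P : MvPolynomial (Fin (n + 2)) K) (hP : P.IsHomogeneous d) (hP0 : P ≠ 0)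
    (hNX : Nat.card {x : Projectivization K (Fin (n + 2) → K) |
        MvPolynomial.eval x.rep P = 0} =
      (d - 1) * q ^ n + d * q ^ (n - 1) + ∑ i ∈ Finset.range (n - 1), q ^ i) :
    ∃ v : Fin (n + 2) → K, v ≠ 0 ∧ MvPolynomial.eval v P = 0 ∧
      ∀ i, MvPolynomial.eval v (MvPolynomial.pderiv i P) = 0 := by
  obtain ⟨e, rfl⟩ : ∃ e, d = e + 1 := ⟨d - 1, by omega⟩
  obtain ⟨r, rfl⟩ : ∃ r, q = r + 1 := ⟨q - 1, by omega⟩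
  obtain ⟨k, rfl⟩ : ∃ k, n = k + 1 := ⟨n - 1, by omega⟩
  refine exists_singular_of_card_zeros (by omega) (Fintype.card_fin _) (by omega) (by omega) hP ?_
  have hgeom := geom_sum_mul_add r k
  simp only [Nat.add_sub_cancel] at hNX
  rw [card_zeros_eq hP (by omega), hNX, hK, Nat.add_sub_cancel, add_mul, add_assoc _ _ 1, hgeom,
    pow_succ _ (k + 1), pow_succ _ k]
  ring
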